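/- arXiv:0708.4377 — 3 statements merged into one kernel-verified Lean document; each statement's English description precedes it below -/
import Mathlib

section
/- Let V be a finite-dimensional real inner product space and J an orthogonal complex structure on V. Let A be a map assigning to each X ∈ V a linear endomorphism A(X) of V such that, for every X, A(X) is skew-adjoint (⟨A(X)Y, Z⟩ = −⟨Y, A(X)Z⟩ for all Y, Z) and anticommutes with J (A(X)∘J = −J∘A(X)). Define d(X,Y,Z) = ⟨Y, A(X)Z⟩ + ⟨Z, A(Y)X⟩ + ⟨X, A(Z)Y⟩. Then for all X, Y, Z ∈ V: d(X,Y,Z) − d(X,JY,JZ) + d(JX,JY,Z) + d(JX,Y,JZ) = −2⟨A(X)Y + A(JX)(JY), Z⟩. -/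
open RealInnerProductSpace

/-- The 'remarkable identity' from the proof of Lemma 2.1: if `J` is an orthogonal
complex structure on a finite-dimensional real inner product space `V`, and `A`
assigns to each `X` a skew-adjoint endomorphism anticommuting with `J`, then with
`d X Y Z = ⟪Y, A X Z⟫ + ⟪Z, A Y X⟫ + ⟪X, A Z Y⟫` one has
`d X Y Z − d X (JY) (JZ) + d (JX) (JY) Z + d (JX) Y (JZ) = −2⟪A X Y + A (JX) (JY), Z⟫`. -/
theorem stmt_0 {V : Type*} [NormedAddCommGroup V] [InnerProductSpace ℝ V]
    [FiniteDimensional ℝ V]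
    (J : V →ₗ[ℝ] V) (hJ2 : J ∘ₗ J = -LinearMap.id)
    (hJskew : ∀ X Y : V, ⟪J X, Y⟫ = -⟪X, J Y⟫)
    (A : V → (V →ₗ[ℝ] V))
    (hAskew : ∀ X Y Z : V, ⟪A X Y, Z⟫ = -⟪Y, A X Z⟫)
    (hAanti : ∀ X : V, (A X) ∘ₗ J = -(J ∘ₗ A X))
    (d : V → V → V → ℝ)
    (hd : ∀ X Y Z : V, d X Y Z = ⟪Y, A X Z⟫ + ⟪Z, A Y X⟫ + ⟪X, A Z Y⟫) :
    ∀ X Y Z : V,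
      d X Y Z - d X (J Y) (J Z) + d (J X) (J Y) Z + d (J X) Y (J Z)
        = -2 * ⟪A X Y + A (J X) (J Y), Z⟫ := by
  have hJJ : ∀ X, J (J X) = -X := fun X => by
    simpa using LinearMap.congr_fun hJ2 X
  have hAJ : ∀ X Y, A X (J Y) = -J (A X Y) := fun X Y => by
    simpa using LinearMap.congr_fun (hAanti X) Y
  have h2 : ∀ X Y Z, ⟪J Y, A X Z⟫ = ⟪Y, A X (J Z)⟫ := fun X Y Z => by
    rw [hJskew, hAJ, inner_neg_right]
  have h1 : ∀ X Y Z, ⟪J Y, A X (J Z)⟫ = -⟪Y, A X Z⟫ := fun X Y Z => by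
    rw [h2, hJJ, map_neg, inner_neg_right]
  intro X Y Z
  rw [inner_add_left, hAskew X Y Z, hAskew (J X) (J Y) Z]
  simp only [hd]
  linarith [h1 X Y Z, h2 (J X) Y Z, h1 Y Z X, h2 (J Y) Z X, h1 Z X Y, h2 (J Z) X Y]
end

section
/- Let V be a finite-dimensional real inner product space and J an orthogonal complex structure on V. Let A be a map assigning to each X ∈ V a linear endomorphism A(X) of V such that, for every X, A(X) is skew-adjoint and anticommutes with J. Define d(X,Y,Z) = ⟨Y, A(X)Z⟩ + ⟨Z, A(Y)X⟩ + ⟨X, A(Z)Y⟩. If d(X,Y,Z) = 0 for all X, Y, Z ∈ V, then A(JX)(JY) = −A(X)(Y) for all X, Y ∈ V. -/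
open RealInnerProductSpace

/-- Pointwise linear-algebra content of Lemma 2.1: if `J` is an orthogonal complex
structure, `A` assigns to each `X` a skew-adjoint endomorphism anticommuting with `J`,
and the cyclic sum `d X Y Z = ⟪Y, A X Z⟫ + ⟪Z, A Y X⟫ + ⟪X, A Z Y⟫` vanishes
identically, then `A (JX) (JY) = −A X Y` for all `X, Y`. -/
theorem stmt_1 {V : Type*} [NormedAddCommGroup V] [InnerProductSpace ℝ V]
    [FiniteDimensional ℝ V]
    (J : V →ₗ[ℝ] V) (hJ2 : J ∘ₗ J = -LinearMap.id)
    (hJskew : ∀ X Y : V, ⟪J X, Y⟫ = -⟪X, J Y⟫)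
    (A : V → (V →ₗ[ℝ] V))
    (hAskew : ∀ X Y Z : V, ⟪A X Y, Z⟫ = -⟪Y, A X Z⟫)
    (hAanti : ∀ X : V, (A X) ∘ₗ J = -(J ∘ₗ A X))
    (d : V → V → V → ℝ)
    (hd : ∀ X Y Z : V, d X Y Z = ⟪Y, A X Z⟫ + ⟪Z, A Y X⟫ + ⟪X, A Z Y⟫)
    (hd0 : ∀ X Y Z : V, d X Y Z = 0) :
    ∀ X Y : V, A (J X) (J Y) = -(A X Y) := by
  have hJ : ∀ X, J (J X) = -X := fun X => by
    simpa using LinearMap.congr_fun hJ2 X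
  have hA : ∀ X Y, A X (J Y) = -J (A X Y) := fun X Y => by
    simpa using LinearMap.congr_fun (hAanti X) Y
  have move : ∀ X Y Z : V, ⟪J Y, A X Z⟫ = ⟪Y, A X (J Z)⟫ := fun X Y Z => by
    rw [hJskew, hA, inner_neg_right]
  have both : ∀ X Y Z : V, ⟪J Y, A X (J Z)⟫ = -⟪Y, A X Z⟫ := fun X Y Z => by
    rw [move, hJ, map_neg, inner_neg_right]
  have cyc : ∀ X Y Z : V, ⟪Y, A X Z⟫ + ⟪Z, A Y X⟫ + ⟪X, A Z Y⟫ = 0 := fun X Y Z => by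
    rw [← hd, hd0]
  intro X Z
  refine ext_inner_left ℝ fun Y => ?_
  rw [inner_neg_right]
  have h0 := cyc X Y Z
  have h1 := cyc (J X) (J Y) Z
  have h2 := cyc (J X) Y (J Z)
  have h3 := cyc X (J Y) (J Z)
  rw [move, both] at h1
  rw [both, move] at h2
  rw [both, move] at h3
  linarith
end

section
/- Let V be a finite-dimensional real inner product space with orthonormal basis (F_1, …, F_m), J an orthogonal complex structure on V, and h a self-adjoint linear endomorphism of V that anticommutes with J (h∘J = −J∘h). Define r(u,v)w = ⟨v,w⟩u − ⟨u,w⟩v. Then Σ_i [(id + h)∘r(F_i, JF_i)∘(id + h), J] = 0, where [P, Q] = P∘Q − Q∘P. -/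
open RealInnerProductSpace

/-- The curvature-type tensor `r u v w = ⟪v,w⟫ • u − ⟪u,w⟫ • v`, as a linear
endomorphism in `w`. -/
noncomputable def rEnd {V : Type*} [NormedAddCommGroup V] [InnerProductSpace ℝ V]
    (u v : V) : V →ₗ[ℝ] V where
  toFun w := ⟪v, w⟫ • u - ⟪u, w⟫ • v
  map_add' w w' := by
    simp [inner_add_right, add_smul]; abel
  map_smul' c w := by
    simp [inner_smul_right, smul_smul, smul_sub]

/-- The summed commutator identity in the proof of Theorem 2.3: if `J` is an orthogonal
complex structure, `h` is self-adjoint and anticommutes with `J`, and `(Fᵢ)` is an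
orthonormal basis, then `∑ i, [(id + h)∘r(Fᵢ, JFᵢ)∘(id + h), J] = 0`. -/
theorem stmt_5 {V : Type*} [NormedAddCommGroup V] [InnerProductSpace ℝ V]
    [FiniteDimensional ℝ V]
    (m : ℕ) (b : OrthonormalBasis (Fin m) ℝ V)
    (J : V →ₗ[ℝ] V) (hJ2 : J ∘ₗ J = -LinearMap.id)
    (hJskew : ∀ X Y : V, ⟪J X, Y⟫ = -⟪X, J Y⟫)
    (h : V →ₗ[ℝ] V)
    (hself : ∀ X Y : V, ⟪h X, Y⟫ = ⟪X, h Y⟫)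
    (hanti : h ∘ₗ J = -(J ∘ₗ h)) :
    ∑ i, (((LinearMap.id + h) ∘ₗ rEnd (b i) (J (b i)) ∘ₗ (LinearMap.id + h)) ∘ₗ J
      - J ∘ₗ ((LinearMap.id + h) ∘ₗ rEnd (b i) (J (b i)) ∘ₗ (LinearMap.id + h))) = 0 := by
  have key : ∀ w : V, ∑ i, rEnd (b i) (J (b i)) w = -(2 : ℝ) • J w := by
    intro w
    have h1 : ∑ i, ⟪b i, J w⟫ • b i = J w := b.sum_repr' (J w)
    have h2 : ∑ i, ⟪b i, w⟫ • J (b i) = J w := by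
      conv_rhs => rw [← b.sum_repr' w]
      simp [map_sum]
    have h3 : ∀ i, rEnd (b i) (J (b i)) w = -(⟪b i, J w⟫ • b i) - ⟪b i, w⟫ • J (b i) := by
      intro i
      change ⟪J (b i), w⟫ • b i - ⟪b i, w⟫ • J (b i) = _
      rw [hJskew, neg_smul]
    rw [Finset.sum_congr rfl (fun i _ => h3 i), Finset.sum_sub_distrib,
      Finset.sum_neg_distrib, h1, h2]
    module
  have hJ : ∀ x, J (J x) = -x := fun x => by simpa using LinearMap.congr_fun hJ2 x
  have ha : ∀ x, h (J x) = -J (h x) := fun x => by simpa using LinearMap.congr_fun hanti x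
  ext w
  simp only [LinearMap.sum_apply, LinearMap.sub_apply, LinearMap.comp_apply,
    Finset.sum_sub_distrib, LinearMap.zero_apply]
  rw [← map_sum, ← map_sum, ← map_sum, key, key]
  simp only [LinearMap.add_apply, LinearMap.id_apply, map_add, map_smul, map_neg, hJ, ha]
  module
end
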